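/- Let f : {−1,1}^n → {−1,1} be non-constant. Then the set {r ∈ (−1,1) : f̂({i}, r) = 0 for all i ∈ [n]} has at most deg(f) − 1 elements; in particular it is finite. -/

import Mathlib

open Finset

noncomputable section

/-- ±1 encoding of a Boolean. -/
def pmVal (b : Bool) : ℝ := if b then 1 else -1

/-- Probability weight of the point `x` of the cube under the product measure with
bias vector `r` (coordinate `i` equals `1` with probability `(1 + r i)/2`). -/
def cubeWt {n : ℕ} (r : Fin n → ℝ) (x : Fin n → Bool) : ℝ :=
  ∏ i, (1 + r i * pmVal (x i)) / 2

/-- Expectation of `f : {-1,1}^n → ℝ` under the product measure with bias vector `r`. -/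
def biasedExp {n : ℕ} (r : Fin n → ℝ) (f : (Fin n → Bool) → ℝ) : ℝ :=
  ∑ x : Fin n → Bool, cubeWt r x * f x

/-- The biased character `χ_S(x, r) = ∏_{i ∈ S} (x_i - r_i)/√(1 - r_i²)`. -/
def biasedChi {n : ℕ} (r : Fin n → ℝ) (S : Finset (Fin n)) (x : Fin n → Bool) : ℝ :=
  ∏ i ∈ S, (pmVal (x i) - r i) / Real.sqrt (1 - (r i) ^ 2)

/-- Biased Fourier coefficient `f̂(S, r) = E_r[f · χ_S(·, r)]`. -/
def biasedFourier {n : ℕ} (r : Fin n → ℝ) (f : (Fin n → Bool) → ℝ) (S : Finset (Fin n)) : ℝ :=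
  biasedExp r (fun x => f x * biasedChi r S x)

/-- Weight of the `s`-th Fourier level: `w_s(f, r) = Σ_{|S| = s} f̂(S, r)`. -/
def levelWeight {n : ℕ} (r : Fin n → ℝ) (f : (Fin n → Bool) → ℝ) (s : ℕ) : ℝ :=
  ∑ S ∈ univ.filter (fun S : Finset (Fin n) => S.card = s), biasedFourier r f S

open Classical in
/-- Degree of `f`: the largest `|S|` with `f̂(S, 0) ≠ 0`. -/
def fourierDeg {n : ℕ} (f : (Fin n → Bool) → ℝ) : ℕ :=
  (univ.filter (fun S : Finset (Fin n) => biasedFourier (fun _ => (0 : ℝ)) f S ≠ 0)).sup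
    Finset.card

/-- The expectation under bias `r` is the multilinear extension of `f` evaluated at `r`. -/
theorem biasedExp_eq_sum_biasedFourier_zero {n : ℕ} (r : Fin n → ℝ) (f : (Fin n → Bool) → ℝ) :
    biasedExp r f =
      ∑ S : Finset (Fin n), biasedFourier (fun _ => (0 : ℝ)) f S * ∏ i ∈ S, r i := by
  have hwt (x : Fin n → Bool) : cubeWt r x =
      ∑ S : Finset (Fin n), cubeWt (fun _ => (0 : ℝ)) x *
        (biasedChi (fun _ => (0 : ℝ)) S x * ∏ i ∈ S, r i) := by
    rw [← Finset.mul_sum]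
    have h : ∏ i, (1 + r i * pmVal (x i)) =
        ∑ S : Finset (Fin n), biasedChi (fun _ => (0 : ℝ)) S x * ∏ i ∈ S, r i := by
      rw [Finset.prod_one_add, Finset.powerset_univ]
      refine Finset.sum_congr rfl fun S _ => ?_
      simp [biasedChi, Finset.prod_mul_distrib, mul_comm]
    rw [← h, cubeWt, cubeWt, ← Finset.prod_mul_distrib]
    exact Finset.prod_congr rfl fun i _ => by ring
  simp only [biasedExp, biasedFourier, hwt, Finset.sum_mul]
  rw [Finset.sum_comm]
  exact Finset.sum_congr rfl fun S _ => Finset.sum_congr rfl fun x _ => by ring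

/-- The polynomial in `r` giving the expectation of `f` under the `r`-biased measure. -/
def biasPoly {n : ℕ} (f : (Fin n → Bool) → ℝ) : Polynomial ℝ :=
  ∑ S : Finset (Fin n),
    Polynomial.C (biasedFourier (fun _ => (0 : ℝ)) f S) * Polynomial.X ^ S.card

theorem eval_biasPoly {n : ℕ} (f : (Fin n → Bool) → ℝ) (r : ℝ) :
    (biasPoly f).eval r = biasedExp (fun _ => r) f := by
  simp [biasPoly, Polynomial.eval_finsetSum, biasedExp_eq_sum_biasedFourier_zero]

theorem natDegree_biasPoly_le {n : ℕ} (f : (Fin n → Bool) → ℝ) :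
    (biasPoly f).natDegree ≤ fourierDeg f := by
  classical
  refine Polynomial.natDegree_sum_le_of_forall_le _ _ fun S _ => ?_
  by_cases h : biasedFourier (fun _ => (0 : ℝ)) f S = 0
  · simp [h]
  · exact (Polynomial.natDegree_C_mul_X_pow_le _ _).trans
      (Finset.le_sup (f := Finset.card) (by simpa using h))

theorem pmVal_mul_self (b : Bool) : pmVal b * pmVal b = 1 := by
  cases b <;> norm_num [pmVal]

/-- Tilting the biased weight by `x_i - r` replaces the `i`-th factor by its derivative in `r`,
up to the factor `1 - r ^ 2`. -/
theorem cubeWt_mul_sub {n : ℕ} (r : ℝ) (x : Fin n → Bool) (i : Fin n) :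
    cubeWt (fun _ => r) x * (pmVal (x i) - r) =
      (1 - r ^ 2) * ((∏ j ∈ univ.erase i, (1 + r * pmVal (x j)) / 2) * (pmVal (x i) / 2)) := by
  rw [cubeWt, ← Finset.mul_prod_erase univ _ (Finset.mem_univ i)]
  linear_combination (r / 2 * ∏ j ∈ univ.erase i, (1 + r * pmVal (x j)) / 2) *
    pmVal_mul_self (x i)

/-- The derivative of the expectation in the bias is a multiple of the first Fourier level. -/
theorem one_sub_sq_mul_eval_derivative_biasPoly {n : ℕ} (f : (Fin n → Bool) → ℝ) {r : ℝ}
    (hr : r ∈ Set.Ioo (-1 : ℝ) 1) :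
    (1 - r ^ 2) * (biasPoly f).derivative.eval r =
      √(1 - r ^ 2) * ∑ i, biasedFourier (fun _ => r) f {i} := by
  have hσ : √(1 - r ^ 2) ≠ 0 := (Real.sqrt_pos.2 (by nlinarith [hr.1, hr.2])).ne'
  have hd : HasDerivAt (fun t : ℝ => biasedExp (fun _ => t) f)
      (∑ x : Fin n → Bool, (∑ i, (∏ j ∈ univ.erase i, (1 + r * pmVal (x j)) / 2) *
        (pmVal (x i) / 2)) * f x) r := by
    refine HasDerivAt.fun_sum fun x _ => HasDerivAt.mul_const ?_ _
    have h := HasDerivAt.fun_finsetProd (u := (univ : Finset (Fin n)))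
      (f := fun i (t : ℝ) => (1 + t * pmVal (x i)) / 2) (f' := fun i => pmVal (x i) / 2) (x := r)
      fun i _ => by
        simpa using (((hasDerivAt_id r).mul_const (pmVal (x i))).const_add 1).div_const 2
    simpa [cubeWt] using h
  have hP := (biasPoly f).hasDerivAt r
  simp only [eval_biasPoly] at hP
  rw [hP.unique hd, Finset.mul_sum, Finset.mul_sum]
  simp only [biasedFourier, biasedExp, Finset.mul_sum, Finset.sum_mul]
  rw [Finset.sum_comm]
  refine Finset.sum_congr rfl fun i _ => Finset.sum_congr rfl fun x _ => ?_
  rw [← mul_assoc, ← cubeWt_mul_sub]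
  simp only [biasedChi, Finset.prod_singleton]
  field_simp

theorem biasedExp_one {n : ℕ} (f : (Fin n → Bool) → ℝ) :
    biasedExp (fun _ => (1 : ℝ)) f = f fun _ => true := by
  rw [biasedExp, Finset.sum_eq_single fun _ => true]
  · simp [cubeWt, pmVal]
  · intro x _ hx
    obtain ⟨i, hi⟩ := Function.ne_iff.1 hx
    rw [cubeWt, Finset.prod_eq_zero (Finset.mem_univ i), zero_mul]
    simp [pmVal, hi]
  · simp

theorem biasedExp_zero {n : ℕ} (f : (Fin n → Bool) → ℝ) :
    biasedExp (fun _ => (0 : ℝ)) f = (1 / 2) ^ n * ∑ x, f x := by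
  simp [biasedExp, cubeWt, Finset.mul_sum]

theorem derivative_biasPoly_ne_zero {n : ℕ} (f : (Fin n → Bool) → ℝ)
    (hpm : ∀ x, f x = 1 ∨ f x = -1) (hnc : ∃ x y, f x ≠ f y) :
    (biasPoly f).derivative ≠ 0 := by
  intro h
  set a := f fun _ => true with ha
  have hmean : (1 / 2) ^ n * ∑ x, f x = a := by
    rw [← biasedExp_zero, ha, ← biasedExp_one f, ← eval_biasPoly, ← eval_biasPoly,
      Polynomial.eq_C_of_derivative_eq_zero h]
    simp
  have hsum : ∑ x, (1 - a * f x) = 0 := by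
    have haa : a * a = 1 := by rcases hpm fun _ => true with h | h <;> rw [ha, h] <;> norm_num
    have h2 : (2 : ℝ) ^ n * (1 / 2) ^ n = 1 := by rw [← mul_pow]; norm_num
    rw [Finset.sum_sub_distrib, ← Finset.mul_sum]
    simp only [Finset.sum_const, Finset.card_univ, Fintype.card_pi, Fintype.card_bool,
      Finset.prod_const, Fintype.card_fin, nsmul_eq_mul, Nat.cast_pow, Nat.cast_ofNat, mul_one]
    linear_combination -(2 : ℝ) ^ n * a * hmean - (2 : ℝ) ^ n * haa + a * (∑ x, f x) * h2
  have hnonneg (x : Fin n → Bool) : 0 ≤ 1 - a * f x := by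
    rcases hpm fun _ => true with h | h <;> rcases hpm x with h' | h' <;>
      rw [ha, h, h'] <;> norm_num
  have hconst (x : Fin n → Bool) : f x = a := by
    have hx := (Finset.sum_eq_zero_iff_of_nonneg fun x _ => hnonneg x).1 hsum x (Finset.mem_univ x)
    rcases hpm fun _ => true with h | h <;> rw [← ha] at h <;> rw [h] at hx ⊢ <;> linarith
  obtain ⟨x, y, hxy⟩ := hnc
  exact hxy ((hconst x).trans (hconst y).symm)

/-- For a non-constant `f : {-1,1}^n → {-1,1}`, the set of biases
`r ∈ (-1,1)` at which all first-level Fourier coefficients vanish is finite, of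
cardinality at most `deg(f) - 1`. -/
theorem stmt14 {n : ℕ} (f : (Fin n → Bool) → ℝ)
    (hpm : ∀ x, f x = 1 ∨ f x = -1)
    (hnc : ∃ x y, f x ≠ f y) :
    {r : ℝ | r ∈ Set.Ioo (-1 : ℝ) 1 ∧
        ∀ i : Fin n, biasedFourier (fun _ => r) f {i} = 0}.Finite ∧
    {r : ℝ | r ∈ Set.Ioo (-1 : ℝ) 1 ∧
        ∀ i : Fin n, biasedFourier (fun _ => r) f {i} = 0}.ncard ≤ fourierDeg f - 1 := by
  classical
  have hne := derivative_biasPoly_ne_zero f hpm hnc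
  have hsub : {r : ℝ | r ∈ Set.Ioo (-1 : ℝ) 1 ∧
      ∀ i : Fin n, biasedFourier (fun _ => r) f {i} = 0} ⊆
      ((biasPoly f).derivative.roots.toFinset : Set ℝ) := by
    rintro r ⟨hr, h0⟩
    have hpos : 0 < 1 - r ^ 2 := by nlinarith [hr.1, hr.2]
    have h := one_sub_sq_mul_eval_derivative_biasPoly f hr
    simp only [h0, Finset.sum_const_zero, mul_zero] at h
    simpa [hne] using (mul_eq_zero.1 h).resolve_left hpos.ne'
  refine ⟨(Finset.finite_toSet _).subset hsub, ?_⟩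
  calc _ ≤ (biasPoly f).derivative.roots.toFinset.card := by
        rw [← Set.ncard_coe_finset]
        exact Set.ncard_le_ncard hsub (Finset.finite_toSet _)
    _ ≤ (biasPoly f).derivative.natDegree :=
        (Multiset.toFinset_card_le _).trans (Polynomial.card_roots' _)
    _ ≤ (biasPoly f).natDegree - 1 := Polynomial.natDegree_derivative_le _
    _ ≤ fourierDeg f - 1 := Nat.sub_le_sub_right (natDegree_biasPoly_le f) 1
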